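/- Let D be a Noetherian integral domain with fraction field K, and let Delta be the set of valuation overrings of D that are Noetherian rings (equivalently, Delta is the union of {K} and the set of discrete valuation overrings of D). Then Delta is compact in the Zariski topology if and only if dim(D) ≤ 1. -/

import Mathlib

/-- The Zariski topology on the set of valuation subrings of a field `K`. -/
instance zariskiTopology (K : Type*) [Field K] : TopologicalSpace (ValuationSubring K) :=
  TopologicalSpace.generateFrom {U | ∃ x : K, U = {V : ValuationSubring K | x ∈ V}}

/-- The Zariski space `Zar(D)`: valuation subrings of `K` containing the image of `D`. -/
def zarSet (D K : Type*) [CommRing D] [Field K] [Algebra D K] : Set (ValuationSubring K) :=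
  {V | ∀ d : D, algebraMap D K d ∈ V}


lemma stab_aux {D : Type*} [CommRing D] [IsDomain D] [IsNoetherianRing D]
    (hdim : ringKrullDim D ≤ 1) {a : D} (ha : a ≠ 0) (I : ℕ → Ideal D) (hI : Antitone I)
    (haI : ∀ n, a ∈ I n) : ∃ n, ∀ m, n ≤ m → I n = I m := by
  have h0 : ringKrullDim (D ⧸ Ideal.span {a}) ≤ 0 := by
    have h := ringKrullDim_quotient_succ_le_of_nonZeroDivisor (mem_nonZeroDivisors_of_ne_zero ha)
    have h2 := h.trans hdim
    generalize ringKrullDim (D ⧸ Ideal.span {a}) = r at h2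
    induction r with
    | bot => exact bot_le
    | coe r =>
      induction r with
      | top => exact absurd h2 (by decide)
      | coe r =>
        have h3 : r + 1 ≤ 1 := by exact_mod_cast h2
        have h4 : r ≤ 0 := by omega
        exact_mod_cast h4
  have : Ring.KrullDimLE 0 (D ⧸ Ideal.span {a}) := by
    rw [Ring.KrullDimLE, Order.krullDimLE_iff]; exact_mod_cast h0
  have : IsArtinianRing (D ⧸ Ideal.span {a}) := isArtinianRing_iff_krullDimLE_zero.mpr this
  let f : ℕ →o (Ideal (D ⧸ Ideal.span {a}))ᵒᵈ :=
    ⟨fun n => OrderDual.toDual ((I n).map (Ideal.Quotient.mk (Ideal.span {a}))),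
      fun i j hij => Ideal.map_mono (hI hij)⟩
  obtain ⟨n, hn⟩ := IsArtinian.monotone_stabilizes f
  refine ⟨n, fun m hm => ?_⟩
  have h1 : (I n).map (Ideal.Quotient.mk (Ideal.span {a})) =
    (I m).map (Ideal.Quotient.mk (Ideal.span {a})) := hn m hm
  have h2 := congrArg (Ideal.comap (Ideal.Quotient.mk (Ideal.span {a}))) h1
  have hle : ∀ k, Ideal.span {a} ≤ I k := fun k => by
    rw [Ideal.span_singleton_le_iff_mem]; exact haI k
  rw [Ideal.comap_map_of_surjective _ Ideal.Quotient.mk_surjective,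
    Ideal.comap_map_of_surjective _ Ideal.Quotient.mk_surjective] at h2
  simpa [← RingHom.ker_eq_comap_bot, Ideal.mk_ker, hle, sup_eq_left.mpr (hle _)] using h2

lemma KA_key {D V : Type*} [CommRing D] [IsDomain D] [IsNoetherianRing D] [CommRing V] [IsDomain V]
    [Algebra D V] (hdim : ringKrullDim D ≤ 1)
    (hfrac : ∀ v : V, ∃ c : D, c ≠ 0 ∧ ∃ b : D, algebraMap D V c * v = algebraMap D V b)
    (hinj : Function.Injective (algebraMap D V)) {a : D} (ha : a ≠ 0) :
    ∃ n, ∀ v : V, ∃ d : D, ∃ w : V,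
      algebraMap D V a ^ n * v = algebraMap D V a ^ (n+1) * w + algebraMap D V d := by
  have haV : algebraMap D V a ≠ 0 := by
    rwa [Ne, map_eq_zero_iff _ hinj]
  obtain ⟨n, hn⟩ := stab_aux hdim ha
    (fun n => (Ideal.span {algebraMap D V a ^ n}).comap (algebraMap D V) ⊔ Ideal.span {a})
    (fun i j hij => by
      refine sup_le_sup_right (Ideal.comap_mono ?_) _
      rw [Ideal.span_singleton_le_span_singleton]
      exact pow_dvd_pow _ hij)
    (fun n => Ideal.mem_sup_right (Ideal.mem_span_singleton_self a))
  refine ⟨n, fun v => ?_⟩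
  -- some N works
  have hex : ∃ N, ∃ d : D, ∃ w : V,
      algebraMap D V a ^ N * v = algebraMap D V a ^ (N+1) * w + algebraMap D V d := by
    obtain ⟨c, hc, b, hb⟩ := hfrac v
    obtain ⟨N, hN⟩ := stab_aux hdim hc (fun n => Ideal.span {a ^ n} ⊔ Ideal.span {c})
      (fun i j hij => by
        refine sup_le_sup_right ?_ _
        rw [Ideal.span_singleton_le_span_singleton]
        exact pow_dvd_pow _ hij)
      (fun n => Ideal.mem_sup_right (Ideal.mem_span_singleton_self c))
    have hm : a ^ N ∈ Ideal.span {a ^ (N+1)} ⊔ Ideal.span {c} := by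
      rw [← hN (N+1) (Nat.le_succ N)]
      exact Ideal.mem_sup_left (Ideal.mem_span_singleton_self _)
    obtain ⟨x, hx, y, hy, hxy⟩ := Submodule.mem_sup.mp hm
    obtain ⟨d, rfl⟩ := Ideal.mem_span_singleton'.mp hx
    obtain ⟨e, rfl⟩ := Ideal.mem_span_singleton'.mp hy
    refine ⟨N, e * b, algebraMap D V d * v, ?_⟩
    have := congrArg (algebraMap D V) hxy
    simp only [map_add, map_mul, map_pow] at this
    rw [← this, map_mul, ← hb]; ring
  -- descend
  have hdesc : ∀ k, (∃ d : D, ∃ w : V,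
      algebraMap D V a ^ (n+k) * v = algebraMap D V a ^ (n+k+1) * w + algebraMap D V d) →
      ∃ d : D, ∃ w : V,
      algebraMap D V a ^ n * v = algebraMap D V a ^ (n+1) * w + algebraMap D V d := by
    intro k
    induction k with
    | zero => exact id
    | succ k ih =>
      rintro ⟨d, w, h⟩
      apply ih
      have hd : d ∈ (Ideal.span {algebraMap D V a ^ (n+(k+1))}).comap (algebraMap D V) ⊔
          Ideal.span {a} := by
        refine Ideal.mem_sup_left ?_
        rw [Ideal.mem_comap, Ideal.mem_span_singleton]
        exact ⟨v - algebraMap D V a * w, by linear_combination -h⟩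
      have h2 := (hn (n+(k+1)) (by omega)).symm.trans (hn (n+(k+1)+1) (by omega))
      rw [h2] at hd
      obtain ⟨x, hx, y, hy, hxy⟩ := Submodule.mem_sup.mp hd
      obtain ⟨e, rfl⟩ := Ideal.mem_span_singleton'.mp hy
      rw [Ideal.mem_comap, Ideal.mem_span_singleton] at hx
      obtain ⟨w', hw'⟩ := hx
      refine ⟨e, w + w', ?_⟩
      apply mul_left_cancel₀ haV
      have := congrArg (algebraMap D V) hxy
      simp only [map_add, map_mul] at this
      rw [← this, hw'] at h
      linear_combination h
  obtain ⟨N, d, w, h⟩ := hex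
  apply hdesc N
  exact ⟨a ^ n * d, w, by
    simp only [map_mul, map_pow]; linear_combination (algebraMap D V a ^ n) * h⟩

lemma KA {D V : Type*} [CommRing D] [IsDomain D] [IsNoetherianRing D] [CommRing V] [IsDomain V]
    [Algebra D V] (hdim : ringKrullDim D ≤ 1)
    (hfrac : ∀ v : V, ∃ c : D, c ≠ 0 ∧ ∃ b : D, algebraMap D V c * v = algebraMap D V b)
    (hinj : Function.Injective (algebraMap D V)) : IsNoetherianRing V := by
  rw [isNoetherianRing_iff, ← monotone_stabilizes_iff_noetherian]
  intro f
  by_cases hb : ∀ m, f m = ⊥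
  · exact ⟨0, fun m _ => by rw [hb, hb]⟩
  push Not at hb
  obtain ⟨m, hm⟩ := hb
  obtain ⟨v, hv, hv0⟩ := Submodule.exists_mem_ne_zero_of_ne_bot hm
  obtain ⟨c, hc, a, hca⟩ := hfrac v
  have ha : a ≠ 0 := by
    rintro rfl
    rw [map_zero, mul_eq_zero, map_eq_zero_iff _ hinj] at hca
    tauto
  have haV : algebraMap D V a ≠ 0 := by
    rwa [Ne, map_eq_zero_iff _ hinj]
  have ham : algebraMap D V a ∈ f m := by
    rw [← hca]; exact Ideal.mul_mem_left _ _ hv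
  obtain ⟨n, hn⟩ := KA_key hdim hfrac hinj ha
  set α := algebraMap D V a
  let c : Ideal V → Ideal D := fun J =>
    (Ideal.span {α ^ n} * J ⊔ Ideal.span {α ^ (n+1)}).comap (algebraMap D V)
  have hcm : Monotone c := fun J J' h =>
    Ideal.comap_mono (sup_le_sup_right (Ideal.mul_mono_right h) _)
  have hcmem : ∀ J d, d ∈ c J ↔ ∃ j ∈ J, ∃ w, algebraMap D V d = α ^ n * j + α ^ (n+1) * w := by
    intro J d
    simp only [c, Ideal.mem_comap, Submodule.mem_sup, Ideal.mem_span_singleton_mul,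
      Ideal.mem_span_singleton]
    constructor
    · rintro ⟨_, ⟨j, hj, rfl⟩, _, ⟨w, rfl⟩, h⟩
      exact ⟨j, hj, w, h.symm⟩
    · rintro ⟨j, hj, w, h⟩
      exact ⟨_, ⟨j, hj, rfl⟩, _, ⟨w, rfl⟩, h.symm⟩
  obtain ⟨N, hN⟩ := (monotone_stabilizes_iff_noetherian (R := D) (M := D)).mpr inferInstance
    ⟨fun k => c (f (m + k)), fun i j h => hcm (f.monotone (by omega))⟩
  refine ⟨m + N, fun k hk => le_antisymm (f.monotone hk) ?_⟩
  intro j hj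
  obtain ⟨k, rfl⟩ : ∃ l, k = m + l := ⟨k - m, by omega⟩
  have hck : c (f (m + N)) = c (f (m + k)) := hN k (by omega)
  obtain ⟨d, w, hd⟩ := hn j
  have h1 : d ∈ c (f (m + k)) := (hcmem _ _).mpr ⟨j, hj, -w, by linear_combination -hd⟩
  rw [← hck, hcmem] at h1
  obtain ⟨j', hj', w', h'⟩ := h1
  have : j = j' + (w + w') * α := by
    apply mul_left_cancel₀ (pow_ne_zero n haV)
    linear_combination hd + h'
  rw [this]
  exact add_mem hj' (Ideal.mul_mem_left _ _ (f.monotone (by omega) ham))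

lemma KA_val {D K : Type*} [CommRing D] [IsDomain D] [IsNoetherianRing D] [Field K]
    [Algebra D K] [IsFractionRing D K] (hdim : ringKrullDim D ≤ 1) (V : ValuationSubring K)
    (hV : V ∈ zarSet D K) : IsNoetherianRing V := by
  let _ : Algebra D V := ((algebraMap D K).codRestrict V.toSubring hV).toAlgebra
  have hval : ∀ d : D, ((algebraMap D V d : V) : K) = algebraMap D K d := fun d => rfl
  refine KA (D := D) hdim ?_ ?_
  · intro v
    obtain ⟨b, c, hc, h⟩ := IsFractionRing.div_surjective D (v : K)
    have hc0 : c ≠ 0 := nonZeroDivisors.ne_zero hc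
    refine ⟨c, hc0, b, Subtype.ext ?_⟩
    have : algebraMap D K c ≠ 0 := by simpa using hc0
    change algebraMap D K c * (v : K) = algebraMap D K b
    rw [← h]; field_simp
  · intro x y h
    apply IsFractionRing.injective D K
    exact congrArg Subtype.val h

lemma noeth_of_le {K : Type*} [Field K] {W V : ValuationSubring K} (h : W ≤ V)
    (hW : IsNoetherianRing W) : IsNoetherianRing V := by
  rw [← W.ofPrime_idealOfLE V h]
  exact IsLocalization.isNoetherianRing (W.idealOfLE V h).primeCompl _ hW

/-- Chevalley type extension for subalgebras. -/
lemma exists_val {D K : Type*} [CommRing D] [Field K] [Algebra D K] (B : Subalgebra D K)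
    (I : Ideal B) (hI : I ≠ ⊤) : ∃ W : ValuationSubring K, (∀ x ∈ B, x ∈ W) ∧
      ∀ x : B, x ∈ I → (x : K) ∈ W.nonunits := by
  obtain ⟨W, h1, h2⟩ := Ideal.image_subset_nonunits_valuationSubring (A := B.toSubring) I hI
  exact ⟨W, fun x hx => h1 hx, fun x hx => h2 ⟨x, hx, rfl⟩⟩

/-- Density: finitely many elements outside `V` are outside some Noetherian valuation overring. -/
lemma dense_aux {D K : Type*} [CommRing D] [IsDomain D] [IsNoetherianRing D] [Field K]
    [Algebra D K] [IsFractionRing D K] (V : ValuationSubring K) (hV : V ∈ zarSet D K)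
    (F : Finset K) (hF : ∀ x ∈ F, x ∉ V) (hne : F.Nonempty) :
    ∃ W ∈ zarSet D K, IsNoetherianRing W ∧ ∀ x ∈ F, x ∉ W := by
  classical
  obtain ⟨x₀, hx₀, hmin⟩ := F.exists_min_image (fun x => V.valuation x) hne
  have hF0 : ∀ x ∈ F, x ≠ 0 := by
    rintro x hx rfl
    exact hF _ hx V.zero_mem
  let S : Finset K := insert x₀⁻¹ (F.image fun x => x₀ / x)
  let B : Subalgebra D K := Algebra.adjoin D (S : Set K)
  have : IsNoetherianRing B := isNoetherianRing_of_fg (Subalgebra.fg_adjoin_finset S)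
  have hx0V : x₀⁻¹ ∈ V.nonunits := V.inv_mem_nonunits_iff.mpr (Or.inr (hF _ hx₀))
  have hBV : ∀ x ∈ B, x ∈ V := by
    intro x hx
    induction hx using Algebra.adjoin_induction with
    | mem x hx =>
      simp only [S, Finset.coe_insert, Finset.coe_image, Set.mem_insert_iff, Set.mem_image,
        Finset.mem_coe] at hx
      rcases hx with rfl | ⟨x, hx, rfl⟩
      · exact V.nonunits_subset hx0V
      · rw [← V.valuation_le_one_iff, map_div₀]
        exact div_le_one_of_le₀ (hmin x hx) zero_le
    | algebraMap r => exact hV r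
    | add x y _ _ hx hy => exact V.add_mem _ _ hx hy
    | mul x y _ _ hx hy => exact V.mul_mem _ _ hx hy
  let y : B := ⟨x₀⁻¹, Algebra.subset_adjoin (by simp [S])⟩
  have hy : Ideal.span {y} ≠ ⊤ := by
    rw [Ne, Ideal.span_singleton_eq_top]
    intro hu
    obtain ⟨z, hz⟩ := hu.exists_right_inv
    have hz' : x₀⁻¹ * (z : K) = 1 := congrArg Subtype.val hz
    have : x₀ = z := by
      have := hF0 _ hx₀
      field_simp at hz'
      exact hz'.symm
    exact hF _ hx₀ (this ▸ hBV z z.2)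
  obtain ⟨p, hp⟩ := Ideal.nonempty_minimalPrimes hy
  have hpp : p.IsPrime := hp.1.1
  have hyp : y ∈ p := hp.1.2 (Ideal.mem_span_singleton_self y)
  have hht : p.height ≤ 1 := Ideal.height_le_one_of_isPrincipal_of_mem_minimalPrimes _ p hp
  let C : Subalgebra B K := Localization.subalgebra.ofField K p.primeCompl
    p.primeCompl_le_nonZeroDivisors
  have hloc : IsLocalization.AtPrime C p := Localization.subalgebra.isLocalization_ofField K _ _
  have hCN : IsNoetherianRing C := IsLocalization.isNoetherianRing p.primeCompl C inferInstance
  have hCd : ringKrullDim C ≤ 1 := by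
    rw [IsLocalization.AtPrime.ringKrullDim_eq_height p C]
    exact_mod_cast hht
  have hlr : IsLocalRing C := IsLocalization.AtPrime.isLocalRing C p
  obtain ⟨W, hW1, hW2⟩ := exists_val C (IsLocalRing.maximalIdeal C) (Ideal.IsPrime.ne_top')
  have hBW : ∀ b : B, (b : K) ∈ W := fun b => hW1 _ (C.algebraMap_mem b)
  refine ⟨W, fun d => hBW (algebraMap D B d), KA_val hCd W fun c => hW1 _ c.2, ?_⟩
  have hyW : x₀⁻¹ ∈ W.nonunits := by
    refine hW2 (algebraMap B C y) ?_
    exact (IsLocalization.AtPrime.to_map_mem_maximal_iff C p y).mpr hyp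
  intro x hx hxW
  have h1 : x₀ / x ∈ W := hBW ⟨x₀ / x, Algebra.subset_adjoin (by
    simp only [S, Finset.coe_insert, Finset.coe_image]
    exact Or.inr ⟨x, hx, rfl⟩)⟩
  have h2 := (W.inv_mem_nonunits_iff.mp hyW).resolve_left (hF0 _ hx₀)
  apply h2
  have := W.mul_mem _ _ h1 hxW
  rwa [div_mul_cancel₀ _ (hF0 x hx)] at this

lemma zar_noeth_of_compact {D K : Type*} [CommRing D] [IsDomain D] [IsNoetherianRing D] [Field K]
    [Algebra D K] [IsFractionRing D K]
    (hc : IsCompact {V : ValuationSubring K | V ∈ zarSet D K ∧ IsNoetherianRing V})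
    (V : ValuationSubring K) (hV : V ∈ zarSet D K) : IsNoetherianRing V := by
  classical
  by_contra hN
  obtain ⟨t, ht⟩ := hc.elim_finite_subcover
    (fun x : {x : K // x ∉ V} => {W : ValuationSubring K | x.1 ∈ W})
    (fun x => TopologicalSpace.isOpen_generateFrom_of_mem ⟨x.1, rfl⟩) (by
      rintro W ⟨_, hW⟩
      have : ¬ W ≤ V := fun h => hN (noeth_of_le h hW)
      obtain ⟨x, hx, hxV⟩ := SetLike.not_le_iff_exists.mp this
      exact Set.mem_iUnion.mpr ⟨⟨x, hxV⟩, hx⟩)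
  have hne : t.Nonempty := by
    by_contra h
    rw [Finset.not_nonempty_iff_eq_empty] at h
    subst h
    have : IsNoetherianRing (⊤ : ValuationSubring K) := by
      have e : (⊤ : Subring K) ≃+* K := Subring.topEquiv
      exact isNoetherianRing_of_ringEquiv K e.symm
    simpa using ht (show (⊤ : ValuationSubring K) ∈ _ from
      ⟨fun d => ValuationSubring.mem_top _, this⟩)
  obtain ⟨W, hW, hWN, hWF⟩ := dense_aux V hV (t.image Subtype.val)
    (by intro x hx; obtain ⟨z, _, rfl⟩ := Finset.mem_image.mp hx; exact z.2)
    (hne.image _)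
  have := ht ⟨hW, hWN⟩
  simp only [Set.mem_iUnion] at this
  obtain ⟨z, hz, hzW⟩ := this
  exact hWF z.1 (Finset.mem_image_of_mem _ hz) hzW

lemma isCompact_zarSet {D K : Type*} [CommRing D] [Field K] [Algebra D K] :
    IsCompact (zarSet D K) := by
  classical
  refine isCompact_generateFrom rfl fun P hP hcov => ?_
  by_contra hno
  push Not at hno
  let X : Set K := {x | {V : ValuationSubring K | x ∈ V} ∈ P}
  let B : Subalgebra D K := Algebra.adjoin D ((·⁻¹) '' X)
  let g : X → B := fun x => ⟨(x : K)⁻¹, Algebra.subset_adjoin ⟨x, x.2, rfl⟩⟩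
  have h0 : (0 : K) ∉ X := by
    intro h
    refine hno {{V : ValuationSubring K | (0:K) ∈ V}} (Set.singleton_subset_iff.mpr h) (Set.finite_singleton _) ?_
    intro V hV
    exact ⟨_, rfl, V.zero_mem⟩
  by_cases hI : Ideal.span (Set.range g) = ⊤
  · have h1 : (1 : B) ∈ Ideal.span (Set.range g) := by rw [hI]; trivial
    have key : ∀ b ∈ B, ∃ F : Finset K, (F : Set K) ⊆ X ∧ ∀ V ∈ zarSet D K,
        (∀ x ∈ F, x ∉ V) → b ∈ V := by
      intro b hb
      induction hb using Algebra.adjoin_induction with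
      | mem b hb =>
        obtain ⟨x, hx, rfl⟩ := hb
        refine ⟨{x}, by simpa using hx, fun V hV h => ?_⟩
        exact (V.mem_or_inv_mem x).resolve_left (h x (by simp))
      | algebraMap r => exact ⟨∅, by simp, fun V hV _ => hV r⟩
      | add x y _ _ hx hy =>
        obtain ⟨F, hF, h⟩ := hx
        obtain ⟨G, hG, h'⟩ := hy
        exact ⟨F ∪ G, by simp [hF, hG], fun V hV H => V.add_mem _ _
          (h V hV fun x hx => H x (by simp [hx])) (h' V hV fun x hx => H x (by simp [hx]))⟩
      | mul x y _ _ hx hy =>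
        obtain ⟨F, hF, h⟩ := hx
        obtain ⟨G, hG, h'⟩ := hy
        exact ⟨F ∪ G, by simp [hF, hG], fun V hV H => V.mul_mem _ _
          (h V hV fun x hx => H x (by simp [hx])) (h' V hV fun x hx => H x (by simp [hx]))⟩
    have key2 : ∀ b ∈ Ideal.span (Set.range g), ∃ F : Finset K, (F : Set K) ⊆ X ∧ ∀ V ∈ zarSet D K,
        (∀ x ∈ F, x ∉ V) → (b : K) ∈ V.nonunits := by
      intro b hb
      induction hb using Submodule.span_induction with
      | mem b hb =>
        obtain ⟨x, rfl⟩ := hb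
        refine ⟨{x.1}, by simp, fun V hV h => ?_⟩
        exact V.inv_mem_nonunits_iff.mpr (Or.inr (h x (by simp)))
      | zero => exact ⟨∅, by simp, fun V hV _ => V.nonunits.zero_mem⟩
      | add x y _ _ hx hy =>
        obtain ⟨F, hF, h⟩ := hx
        obtain ⟨G, hG, h'⟩ := hy
        exact ⟨F ∪ G, by simp [hF, hG], fun V hV H => V.nonunits.add_mem
          (h V hV fun x hx => H x (by simp [hx])) (h' V hV fun x hx => H x (by simp [hx]))⟩
      | smul r x _ hx =>
        obtain ⟨F, hF, h⟩ := key r r.2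
        obtain ⟨G, hG, h'⟩ := hx
        refine ⟨F ∪ G, by simp [hF, hG], fun V hV H => ?_⟩
        have e1 := h V hV fun x hx => H x (by simp [hx])
        have e2 := h' V hV fun x hx => H x (by simp [hx])
        rw [V.mem_nonunits_iff] at e2 ⊢
        rw [← V.valuation_le_one_iff] at e1
        change V.valuation ((r : K) * (x : K)) < 1
        rw [map_mul]
        exact (mul_le_of_le_one_left zero_le e1).trans_lt e2
    obtain ⟨F, hF, h⟩ := key2 1 h1
    refine hno ((fun x : K => {V : ValuationSubring K | x ∈ V}) '' F) ?_
      (F.finite_toSet.image _) ?_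
    · rintro _ ⟨x, hx, rfl⟩; exact hF hx
    · intro V hV
      by_contra hcon
      have := h V hV fun x hx hxV => hcon ⟨_, ⟨x, hx, rfl⟩, hxV⟩
      rw [V.mem_nonunits_iff] at this
      simp at this
  · obtain ⟨W, hW1, hW2⟩ := exists_val B _ hI
    obtain ⟨U, hU, hWU⟩ := hcov (show W ∈ zarSet D K from fun d => hW1 _ (B.algebraMap_mem d))
    obtain ⟨x, rfl⟩ := hP hU
    have := hW2 (g ⟨x, hU⟩) (Ideal.subset_span ⟨_, rfl⟩)
    rcases W.inv_mem_nonunits_iff.mp this with h | h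
    · exact h0 (h ▸ hU)
    · exact h hWU

/-- The subring `D + P D_P` of `K`. -/
def pullRing (D K : Type*) [CommRing D] [IsDomain D] [Field K] [Algebra D K] [IsFractionRing D K]
    (P : Ideal D) [hP : P.IsPrime] : Subalgebra D K where
  carrier := {x | ∃ d, ∃ p ∈ P, ∃ s ∉ P, x * algebraMap D K s = algebraMap D K (d * s + p)}
  mul_mem' := by
    rintro x y ⟨d, p, hp, s, hs, h⟩ ⟨d', p', hp', s', hs', h'⟩
    refine ⟨d * d', d * s * p' + p * (d' * s') + p * p', ?_, s * s', fun hh =>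
      (hP.mem_or_mem hh).elim hs hs', ?_⟩
    · exact add_mem (add_mem (P.mul_mem_left _ hp') (P.mul_mem_right _ hp)) (P.mul_mem_right _ hp)
    · simp only [map_mul, map_add] at h h' ⊢
      linear_combination (y * algebraMap D K s') * h +
        (algebraMap D K d * algebraMap D K s + algebraMap D K p) * h'
  add_mem' := by
    rintro x y ⟨d, p, hp, s, hs, h⟩ ⟨d', p', hp', s', hs', h'⟩
    refine ⟨d + d', p * s' + p' * s, ?_, s * s', fun hh =>
      (hP.mem_or_mem hh).elim hs hs', ?_⟩
    · exact add_mem (P.mul_mem_right _ hp) (P.mul_mem_right _ hp')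
    · simp only [map_mul, map_add] at h h' ⊢
      linear_combination (algebraMap D K s') * h + (algebraMap D K s) * h'
  algebraMap_mem' r := ⟨r, 0, P.zero_mem, 1, fun h => hP.ne_top ((Ideal.eq_top_iff_one P).mpr h),
    by simp⟩

lemma exists_nonNoeth {D K : Type*} [CommRing D] [IsDomain D] [Field K]
    [Algebra D K] [IsFractionRing D K] (P Q : Ideal D) [hP : P.IsPrime] [hQ : Q.IsPrime]
    (hP0 : P ≠ ⊥) (hPQ : P < Q) : ∃ V ∈ zarSet D K, ¬ IsNoetherianRing V := by
  let B := pullRing D K P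
  have hinj : Function.Injective (algebraMap D K) := IsFractionRing.injective D K
  let I : Ideal B :=
  { carrier := {x | ∃ d ∈ Q, ∃ p ∈ P, ∃ s ∉ P,
      (x : K) * algebraMap D K s = algebraMap D K (d * s + p)}
    zero_mem' := ⟨0, Q.zero_mem, 0, P.zero_mem, 1,
      fun h => hP.ne_top ((Ideal.eq_top_iff_one P).mpr h), by simp⟩
    add_mem' := by
      rintro ⟨x, hx⟩ ⟨y, hy⟩ ⟨d, hd, p, hp, s, hs, h⟩ ⟨d', hd', p', hp', s', hs', h'⟩
      refine ⟨d + d', add_mem hd hd', p * s' + p' * s, ?_, s * s', fun hh =>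
        (hP.mem_or_mem hh).elim hs hs', ?_⟩
      · exact add_mem (P.mul_mem_right _ hp) (P.mul_mem_right _ hp')
      · change (x + y) * _ = _
        simp only [map_mul, map_add] at h h' ⊢
        linear_combination (algebraMap D K s') * h + (algebraMap D K s) * h'
    smul_mem' := by
      rintro ⟨x, d, p, hp, s, hs, h⟩ ⟨y, hy⟩ ⟨d', hd', p', hp', s', hs', h'⟩
      refine ⟨d * d', Q.mul_mem_left _ hd', d * s * p' + p * (d' * s') + p * p', ?_, s * s',
        fun hh => (hP.mem_or_mem hh).elim hs hs', ?_⟩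
      · exact add_mem (add_mem (P.mul_mem_left _ hp') (P.mul_mem_right _ hp))
          (P.mul_mem_right _ hp)
      · change (x * y) * _ = _
        simp only [map_mul, map_add] at h h' ⊢
        linear_combination (y * algebraMap D K s') * h +
          (algebraMap D K d * algebraMap D K s + algebraMap D K p) * h' }
  have hI : I ≠ ⊤ := by
    rw [Ne, Ideal.eq_top_iff_one]
    rintro ⟨d, hd, p, hp, s, hs, h⟩
    have h1 : s = d * s + p := hinj (by simpa using h)
    have h2 : (1 - d) * s ∈ P := by
      have : (1 - d) * s = p := by linear_combination h1
      rwa [this]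
    have h3 := hPQ.le ((hP.mem_or_mem h2).resolve_right hs)
    exact hQ.ne_top ((Ideal.eq_top_iff_one Q).mpr (by simpa using add_mem h3 hd))
  obtain ⟨V, hV1, hV2⟩ := exists_val B I hI
  have hVz : V ∈ zarSet D K := fun d => hV1 _ (B.algebraMap_mem d)
  refine ⟨V, hVz, fun hN => ?_⟩
  obtain ⟨p, hp, hp0⟩ := Submodule.exists_mem_ne_zero_of_ne_bot hP0
  obtain ⟨q, hq, hqP⟩ := SetLike.exists_of_lt hPQ
  have hqV : algebraMap D K q ∈ V.nonunits := by
    refine hV2 ⟨algebraMap D K q, B.algebraMap_mem q⟩ ⟨q, hq, 0, P.zero_mem, 1,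
      fun h => hP.ne_top ((Ideal.eq_top_iff_one P).mpr h), by simp⟩
  have hq0 : algebraMap D K q ≠ 0 := by
    intro h
    have : q = 0 := hinj (by simpa using h)
    exact hqP (this ▸ P.zero_mem)
  have hdiv : ∀ n : ℕ, algebraMap D K p / algebraMap D K q ^ n ∈ V := by
    intro n
    refine hV1 _ ⟨0, p, hp, q ^ n, fun h => hqP (hP.mem_of_pow_mem _ h), ?_⟩
    simp only [map_pow, map_add, map_mul, map_zero, zero_mul, zero_add]
    field_simp
  have hbot := Ideal.iInf_pow_eq_bot_of_isLocalRing (IsLocalRing.maximalIdeal V)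
    (Ideal.IsPrime.ne_top')
  have hmem : (⟨algebraMap D K p, hVz p⟩ : V) ∈ ⨅ i, IsLocalRing.maximalIdeal V ^ i := by
    rw [Ideal.mem_iInf]
    intro n
    have e : (⟨algebraMap D K p, hVz p⟩ : V) = ⟨_, hdiv n⟩ * (⟨algebraMap D K q, hVz q⟩ : V) ^ n := by
      apply Subtype.ext
      change algebraMap D K p = algebraMap D K p / algebraMap D K q ^ n * algebraMap D K q ^ n
      field_simp
    rw [e]
    exact Ideal.mul_mem_left _ _ (Ideal.pow_mem_pow (V.coe_mem_nonunits_iff.mp hqV) n)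
  rw [hbot, Ideal.mem_bot] at hmem
  have : algebraMap D K p = 0 := congrArg Subtype.val hmem
  exact hp0 (hinj (by simpa using this))

theorem stmt16 (D K : Type*) [CommRing D] [IsDomain D] [IsNoetherianRing D] [Field K]
    [Algebra D K] [IsFractionRing D K] :
    IsCompact {V : ValuationSubring K | V ∈ zarSet D K ∧ IsNoetherianRing V} ↔
      ringKrullDim D ≤ 1 := by
  constructor
  · intro hc
    have h : Ring.KrullDimLE 1 D := by
      rw [Ring.krullDimLE_one_iff_of_noZeroDivisors]
      intro P hP0 hP
      by_contra hmax
      obtain ⟨Q, hQ, hPQ⟩ := Ideal.exists_le_maximal P hP.ne_top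
      have hlt : P < Q := lt_of_le_of_ne hPQ (by rintro rfl; exact hmax hQ)
      have := hQ.isPrime
      obtain ⟨V, hV, hVN⟩ := exists_nonNoeth (K := K) P Q hP0 hlt
      exact hVN (zar_noeth_of_compact hc V hV)
    rw [Ring.KrullDimLE, Order.krullDimLE_iff] at h
    exact_mod_cast h
  · intro hdim
    have : {V : ValuationSubring K | V ∈ zarSet D K ∧ IsNoetherianRing V} = zarSet D K := by
      ext V
      exact ⟨fun h => h.1, fun h => ⟨h, KA_val hdim V h⟩⟩
    rw [this]
    exact isCompact_zarSet
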